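/- With φ_j the orthonormal Legendre system on [t,T] and C_{j_2 j_1} = ∫_t^T φ_{j_2}(t_2) (∫_t^{t_2} φ_{j_1}(t_1) dt_1) dt_2, for every integer q ≥ 0 the mean-square truncation error of the double Fourier–Legendre series of the indicator of the set {t_1 < t_2} satisfies ∫_{[t,T]²} (1_{{t_1<t_2}} − ∑_{j_1=0}^q ∑_{j_2=0}^q C_{j_2 j_1} φ_{j_1}(t_1) φ_{j_2}(t_2))² dt_1 dt_2 = ((T−t)²/2) · (1/2 − ∑_{i=1}^q 1/(4i²−1)). -/

import Mathlib

open MeasureTheory intervalIntegral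

/-- The Legendre polynomial `P_j` via the Rodrigues formula. -/
noncomputable def legendreP (j : ℕ) (x : ℝ) : ℝ :=
  (1 / (2 ^ j * (j.factorial : ℝ))) * iteratedDeriv j (fun y : ℝ => (y ^ 2 - 1) ^ j) x

/-- The orthonormal Legendre system `φ_j` on `[t, T]`. -/
noncomputable def legendreFun (t T : ℝ) (j : ℕ) (x : ℝ) : ℝ :=
  Real.sqrt ((2 * j + 1) / (T - t)) * legendreP j ((x - (T + t) / 2) * (2 / (T - t)))

/-- The double Fourier–Legendre coefficient
`C_{j₂ j₁} = ∫_t^T φ_{j₂}(t₂) (∫_t^{t₂} φ_{j₁}(t₁) dt₁) dt₂` of the indicator of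
`{t₁ < t₂}` on `[t,T]²`. -/
noncomputable def doubleCoeff (t T : ℝ) (j₂ j₁ : ℕ) : ℝ :=
  ∫ t₂ in t..T, legendreFun t T j₂ t₂ * ∫ t₁ in t..t₂, legendreFun t T j₁ t₁

open Polynomial

/-- The Legendre polynomial `P_j` as an element of `ℝ[X]`. -/
noncomputable def legendrePoly (j : ℕ) : ℝ[X] :=
  C (1 / (2 ^ j * (j.factorial : ℝ))) * derivative^[j] ((X ^ 2 - 1) ^ j)

/-- The integral over `[-1, 1]`, as a linear functional on real polynomials. -/
noncomputable def polyIntegral : Polynomial ℝ →ₗ[ℝ] ℝ where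
  toFun p := ∫ x in (-1 : ℝ)..1, p.eval x
  map_add' p r := by
    simp only [Polynomial.eval_add]
    exact integral_add (p.continuous.intervalIntegrable _ _) (r.continuous.intervalIntegrable _ _)
  map_smul' c p := by simp

theorem polyIntegral_apply (p : Polynomial ℝ) :
    polyIntegral p = ∫ x in (-1 : ℝ)..1, p.eval x := rfl

namespace Polynomial

theorem iteratedDeriv_eval (p : ℝ[X]) (n : ℕ) :
    iteratedDeriv n (fun x => p.eval x) = fun x => (derivative^[n] p).eval x := by
  induction n with
  | zero => simp
  | succ n ih =>
    rw [iteratedDeriv_succ, ih, Function.iterate_succ_apply']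
    ext x
    exact Polynomial.deriv _

theorem integral_eval_derivative (p : ℝ[X]) (a b : ℝ) :
    ∫ x in a..b, (derivative p).eval x = p.eval b - p.eval a :=
  integral_eq_sub_of_hasDerivAt (fun x _ => p.hasDerivAt x)
    (p.derivative.continuous.intervalIntegrable _ _)

end Polynomial

theorem legendreP_eq_eval (j : ℕ) (x : ℝ) : legendreP j x = (legendrePoly j).eval x := by
  have h : (fun y : ℝ => (y ^ 2 - 1) ^ j) = fun y => ((X ^ 2 - 1 : ℝ[X]) ^ j).eval y := by
    ext y; simp
  rw [legendreP, h, iteratedDeriv_eval, legendrePoly, eval_mul, eval_C]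

theorem polyIntegral_derivative (p : ℝ[X]) :
    polyIntegral (derivative p) = p.eval 1 - p.eval (-1) :=
  integral_eval_derivative p _ _

theorem eval_iterate_derivative_sq_sub_one_pow {m n : ℕ} (h : m < n) {x : ℝ}
    (hx : x ^ 2 = 1) : (derivative^[m] ((X ^ 2 - 1 : ℝ[X]) ^ n)).eval x = 0 := by
  obtain ⟨r, hr⟩ := pow_sub_dvd_iterate_derivative_of_pow_dvd (R := ℝ) m
    (dvd_refl ((X ^ 2 - 1 : ℝ[X]) ^ n))
  rw [hr]
  simp [hx, Nat.sub_ne_zero_of_lt h]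

theorem polyIntegral_iterate_derivative_mul (n : ℕ) (g : ℝ[X]) (k : ℕ) (hk : k ≤ n) :
    polyIntegral (derivative^[n] ((X ^ 2 - 1) ^ n) * g) =
      (-1) ^ k * polyIntegral (derivative^[n - k] ((X ^ 2 - 1) ^ n) * derivative^[k] g) := by
  induction k with
  | zero => simp
  | succ k ih =>
    rw [ih (by lia)]
    obtain ⟨m, rfl⟩ := Nat.exists_eq_add_of_le hk
    have h₁ : k + 1 + m - k = m + 1 := by lia
    have h₂ : k + 1 + m - (k + 1) = m := by lia
    rw [h₁, h₂, Function.iterate_succ_apply', Function.iterate_succ_apply']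
    have key := polyIntegral_derivative
      (derivative^[m] ((X ^ 2 - 1 : ℝ[X]) ^ (k + 1 + m)) * derivative^[k] g)
    rw [derivative_mul, map_add, eval_mul, eval_mul,
      eval_iterate_derivative_sq_sub_one_pow (by lia) (by norm_num),
      eval_iterate_derivative_sq_sub_one_pow (by lia) (by norm_num)] at key
    rw [pow_succ (-1 : ℝ)]
    linear_combination (-1) ^ k * key

theorem natDegree_legendrePoly_le (j : ℕ) : (legendrePoly j).natDegree ≤ j := by
  refine (natDegree_C_mul_le _ _).trans ((natDegree_iterate_derivative _ _).trans ?_)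
  have h : ((X ^ 2 - 1 : ℝ[X]) ^ j).natDegree ≤ j * 2 :=
    natDegree_pow_le_of_le j (by compute_degree)
  lia

theorem polyIntegral_legendrePoly_mul_eq_zero {n : ℕ} {g : ℝ[X]} (h : g.natDegree < n) :
    polyIntegral (legendrePoly n * g) = 0 := by
  rw [legendrePoly, mul_assoc, ← smul_eq_C_mul, map_smul,
    polyIntegral_iterate_derivative_mul n g n le_rfl, iterate_derivative_eq_zero h]
  simp

/-- `P_{j+2} - P_j = (2j+3) ∫_{-1}^x P_{j+1}`, in terms of iterated derivatives. -/
theorem legendrePoly_add_two (j : ℕ) :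
    legendrePoly (j + 2) = legendrePoly j +
      C ((2 * j + 3) * (1 / (2 ^ (j + 1) * ((j + 1).factorial : ℝ)))) *
        derivative^[j] ((X ^ 2 - 1) ^ (j + 1)) := by
  have h : derivative (derivative ((X ^ 2 - 1 : ℝ[X]) ^ (j + 2))) =
      C (2 * (j + 2) * (2 * j + 3) : ℝ) * (X ^ 2 - 1) ^ (j + 1) +
        C (4 * (j + 1) * (j + 2) : ℝ) * (X ^ 2 - 1) ^ j := by
    simp only [derivative_pow, derivative_sub, derivative_mul, derivative_X, derivative_one,
      derivative_C, Nat.add_sub_cancel, show j + 2 - 1 = j + 1 by lia, derivative_zero]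
    simp only [map_mul, map_add, map_ofNat, map_natCast, map_one]
    push_cast
    ring
  have hf : (j.factorial : ℝ) ≠ 0 := by positivity
  rw [legendrePoly, legendrePoly, Function.iterate_add_apply]
  simp only [Function.iterate_succ_apply, Function.iterate_zero_apply]
  rw [h, iterate_map_add derivative, iterate_derivative_C_mul, iterate_derivative_C_mul, mul_add,
    ← mul_assoc, ← mul_assoc, ← C_mul, ← C_mul, add_comm]
  have h₀ : 1 / (2 ^ (j + 2) * ((j + 2).factorial : ℝ)) * (4 * (j + 1) * (j + 2)) =
      1 / (2 ^ j * (j.factorial : ℝ)) := by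
    simp only [Nat.factorial_succ]
    push_cast
    field_simp
    ring
  have h₁ : 1 / (2 ^ (j + 2) * ((j + 2).factorial : ℝ)) * (2 * (j + 2) * (2 * j + 3)) =
      (2 * j + 3) * (1 / (2 ^ (j + 1) * ((j + 1).factorial : ℝ))) := by
    simp only [Nat.factorial_succ]
    push_cast
    field_simp
    ring
  rw [h₀, h₁]

theorem legendrePoly_zero : legendrePoly 0 = 1 := by simp [legendrePoly]

theorem legendrePoly_one : legendrePoly 1 = X := by
  simp only [legendrePoly, Function.iterate_one, pow_one, derivative_sub, derivative_X_pow,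
    derivative_one, Nat.factorial_one]
  norm_num [← mul_assoc, ← C_mul]

theorem eval_legendrePoly_add_two (j : ℕ) {x : ℝ} (hx : x ^ 2 = 1) :
    (legendrePoly (j + 2)).eval x = (legendrePoly j).eval x := by
  rw [legendrePoly_add_two, eval_add, eval_mul,
    eval_iterate_derivative_sq_sub_one_pow (by lia) hx, mul_zero, add_zero]

theorem eval_legendrePoly (j : ℕ) {x : ℝ} (hx : x ^ 2 = 1) :
    (legendrePoly j).eval x = x ^ j := by
  induction j using Nat.twoStepInduction with
  | zero => simp [legendrePoly_zero]
  | one => simp [legendrePoly_one]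
  | more j ih _ => rw [eval_legendrePoly_add_two j hx, ih, pow_add, hx, mul_one]

theorem derivative_legendrePoly_add_two (j : ℕ) :
    derivative (legendrePoly (j + 2)) =
      derivative (legendrePoly j) + C (2 * j + 3 : ℝ) * legendrePoly (j + 1) := by
  rw [legendrePoly_add_two, derivative_add, derivative_C_mul,
    ← Function.iterate_succ_apply' (⇑derivative),
    C_mul, mul_assoc, legendrePoly, legendrePoly]

theorem natDegree_derivative_legendrePoly_lt (j : ℕ) :
    (derivative (legendrePoly j)).natDegree < j + 1 :=
  Nat.lt_succ_of_le ((natDegree_derivative_le _).trans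
    ((Nat.sub_le _ _).trans (natDegree_legendrePoly_le j)))

theorem polyIntegral_legendrePoly_sq (n : ℕ) :
    polyIntegral (legendrePoly n * legendrePoly n) = 2 / (2 * n + 1) := by
  have hparts := polyIntegral_derivative (legendrePoly (n + 1) * legendrePoly n)
  rw [derivative_mul, map_add,
    polyIntegral_legendrePoly_mul_eq_zero (natDegree_derivative_legendrePoly_lt n), eval_mul,
    eval_mul, eval_legendrePoly _ (by norm_num), eval_legendrePoly _ (by norm_num),
    eval_legendrePoly _ (by norm_num), eval_legendrePoly _ (by norm_num), ← pow_add,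
    ← pow_add, show n + 1 + n = 2 * n + 1 by lia, pow_succ (-1 : ℝ), pow_mul] at hparts
  norm_num at hparts
  have hd : polyIntegral (derivative (legendrePoly (n + 1)) * legendrePoly n) =
      (2 * n + 1) * polyIntegral (legendrePoly n * legendrePoly n) := by
    cases n with
    | zero => simp [legendrePoly_zero, legendrePoly_one]
    | succ n =>
      rw [derivative_legendrePoly_add_two, add_mul, map_add,
        mul_comm (derivative (legendrePoly n)),
        polyIntegral_legendrePoly_mul_eq_zero
          (natDegree_derivative_legendrePoly_lt n), mul_assoc, ← smul_eq_C_mul,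
        map_smul, smul_eq_mul, zero_add]
      push_cast
      ring
  rw [hd] at hparts
  field_simp
  linarith

theorem polyIntegral_legendrePoly_mul (m n : ℕ) :
    polyIntegral (legendrePoly m * legendrePoly n) = if m = n then 2 / (2 * (n : ℝ) + 1) else 0 := by
  rcases lt_trichotomy m n with h | rfl | h
  · rw [if_neg h.ne, mul_comm, polyIntegral_legendrePoly_mul_eq_zero
      ((natDegree_legendrePoly_le m).trans_lt h)]
  · rw [if_pos rfl, polyIntegral_legendrePoly_sq]
  · rw [if_neg h.ne', polyIntegral_legendrePoly_mul_eq_zero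
      ((natDegree_legendrePoly_le n).trans_lt h)]

/-- The antiderivative of `P_j` that vanishes at `-1`. -/
noncomputable def legendrePrimitive : ℕ → ℝ[X]
  | 0 => legendrePoly 1 + legendrePoly 0
  | j + 1 => C (1 / (2 * j + 3 : ℝ)) * (legendrePoly (j + 2) - legendrePoly j)

theorem derivative_legendrePrimitive (j : ℕ) :
    derivative (legendrePrimitive j) = legendrePoly j := by
  cases j with
  | zero => simp [legendrePrimitive, legendrePoly_zero, legendrePoly_one]
  | succ j =>
    have h : (2 * j + 3 : ℝ) ≠ 0 := by positivity
    rw [legendrePrimitive, derivative_C_mul, derivative_sub, derivative_legendrePoly_add_two,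
      add_sub_cancel_left, ← mul_assoc, ← C_mul, one_div_mul_cancel h, C_1, one_mul]

theorem eval_legendrePrimitive_neg_one (j : ℕ) : (legendrePrimitive j).eval (-1) = 0 := by
  cases j with
  | zero => simp [legendrePrimitive, legendrePoly_zero, legendrePoly_one]
  | succ j => simp [legendrePrimitive, eval_legendrePoly_add_two j (x := -1) (by norm_num)]

theorem polyIntegral_legendrePoly_mul_primitive_zero (k : ℕ) :
    polyIntegral (legendrePoly k * legendrePrimitive 0) =
      (if k = 1 then 2 / 3 else 0) + if k = 0 then 2 else 0 := by
  rw [legendrePrimitive, mul_add, map_add, polyIntegral_legendrePoly_mul,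
    polyIntegral_legendrePoly_mul]
  norm_num

theorem polyIntegral_legendrePoly_mul_primitive_succ (k j : ℕ) :
    polyIntegral (legendrePoly k * legendrePrimitive (j + 1)) =
      1 / (2 * j + 3) * ((if k = j + 2 then 2 / (2 * (j : ℝ) + 5) else 0) -
        if k = j then 2 / (2 * (j : ℝ) + 1) else 0) := by
  rw [legendrePrimitive, mul_left_comm, ← smul_eq_C_mul, map_smul, mul_sub, map_sub,
    polyIntegral_legendrePoly_mul, polyIntegral_legendrePoly_mul, smul_eq_mul]
  push_cast
  ring_nf

theorem integral_eval_comp_affine {t T : ℝ} (h : t < T) (p : ℝ[X]) (x : ℝ) :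
    ∫ y in t..x, p.eval ((y - (T + t) / 2) * (2 / (T - t))) =
      (T - t) / 2 * ∫ u in (-1 : ℝ)..((x - (T + t) / 2) * (2 / (T - t))), p.eval u := by
  have hL : T - t ≠ 0 := (sub_pos.2 h).ne'
  have e : ∀ y, (y - (T + t) / 2) * (2 / (T - t)) =
      2 / (T - t) * y - (T + t) / (T - t) := fun y => by field_simp
  have h₁ : 2 / (T - t) * t - (T + t) / (T - t) = -1 := by field_simp; ring
  simp_rw [e]
  rw [integral_comp_mul_sub (fun u => p.eval u) (by positivity), h₁, smul_eq_mul, inv_div]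

theorem integral_eval_comp_affine_eq_polyIntegral {t T : ℝ} (h : t < T) (p : ℝ[X]) :
    ∫ y in t..T, p.eval ((y - (T + t) / 2) * (2 / (T - t))) = (T - t) / 2 * polyIntegral p := by
  have hL : T - t ≠ 0 := (sub_pos.2 h).ne'
  have h₂ : (T - (T + t) / 2) * (2 / (T - t)) = 1 := by field_simp; ring
  rw [integral_eval_comp_affine h, h₂, polyIntegral_apply]

theorem legendreFun_eq (t T : ℝ) (j : ℕ) (x : ℝ) :
    legendreFun t T j x = Real.sqrt ((2 * j + 1) / (T - t)) *
      (legendrePoly j).eval ((x - (T + t) / 2) * (2 / (T - t))) := by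
  rw [legendreFun, legendreP_eq_eval]

theorem continuous_legendreFun (t T : ℝ) (j : ℕ) : Continuous (legendreFun t T j) := by
  rw [funext (legendreFun_eq t T j)]
  exact continuous_const.mul ((legendrePoly j).continuous.comp (by fun_prop))

theorem integral_legendreFun_mul {t T : ℝ} (h : t < T) (i j : ℕ) :
    ∫ x in t..T, legendreFun t T i x * legendreFun t T j x = if i = j then 1 else 0 := by
  have hL : 0 < T - t := sub_pos.2 h
  have e : ∀ x, legendreFun t T i x * legendreFun t T j x =
      Real.sqrt ((2 * i + 1) / (T - t)) * Real.sqrt ((2 * j + 1) / (T - t)) *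
        (legendrePoly i * legendrePoly j).eval ((x - (T + t) / 2) * (2 / (T - t))) := fun x => by
    rw [legendreFun_eq, legendreFun_eq, eval_mul]; ring
  simp_rw [e]
  rw [intervalIntegral.integral_const_mul, integral_eval_comp_affine_eq_polyIntegral h,
    polyIntegral_legendrePoly_mul]
  split_ifs with hij
  · subst hij
    rw [Real.mul_self_sqrt (by positivity)]
    field_simp
  · simp

theorem doubleCoeff_eq {t T : ℝ} (h : t < T) (k j : ℕ) :
    doubleCoeff t T k j =
      Real.sqrt ((2 * k + 1) / (T - t)) * Real.sqrt ((2 * j + 1) / (T - t)) *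
        ((T - t) / 2) ^ 2 * polyIntegral (legendrePoly k * legendrePrimitive j) := by
  have hprim : ∀ x, ∫ y in t..x, legendreFun t T j y = Real.sqrt ((2 * j + 1) / (T - t)) *
      ((T - t) / 2 * (legendrePrimitive j).eval ((x - (T + t) / 2) * (2 / (T - t)))) := fun x => by
    simp_rw [legendreFun_eq]
    rw [intervalIntegral.integral_const_mul, integral_eval_comp_affine h,
      ← derivative_legendrePrimitive,
      integral_eval_derivative, eval_legendrePrimitive_neg_one, sub_zero]
  have e : ∀ x, legendreFun t T k x * ∫ y in t..x, legendreFun t T j y =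
      Real.sqrt ((2 * k + 1) / (T - t)) * Real.sqrt ((2 * j + 1) / (T - t)) * ((T - t) / 2) *
        (legendrePoly k * legendrePrimitive j).eval
          ((x - (T + t) / 2) * (2 / (T - t))) := fun x => by
    rw [legendreFun_eq, hprim, eval_mul]; ring
  simp_rw [doubleCoeff, e]
  rw [intervalIntegral.integral_const_mul, integral_eval_comp_affine_eq_polyIntegral h]
  ring

theorem doubleCoeff_sq {t T : ℝ} (h : t < T) (k j : ℕ) :
    doubleCoeff t T k j ^ 2 = (T - t) ^ 2 / 16 * ((2 * k + 1) * (2 * j + 1) *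
      polyIntegral (legendrePoly k * legendrePrimitive j) ^ 2) := by
  have hL : 0 < T - t := sub_pos.2 h
  rw [doubleCoeff_eq h, mul_pow, mul_pow, mul_pow, Real.sq_sqrt (by positivity),
    Real.sq_sqrt (by positivity)]
  field_simp
  ring

theorem doubleCoeff_eq_zero {t T : ℝ} (h : t < T) {k j : ℕ} (h₀ : k = j → k ≠ 0)
    (h₁ : k ≠ j + 1) (h₂ : j ≠ k + 1) : doubleCoeff t T k j = 0 := by
  rw [doubleCoeff_eq h]
  cases j with
  | zero =>
    rw [polyIntegral_legendrePoly_mul_primitive_zero, if_neg (by lia), if_neg (by lia)]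
    simp
  | succ j =>
    rw [polyIntegral_legendrePoly_mul_primitive_succ, if_neg (by lia), if_neg (by lia)]
    simp

theorem doubleCoeff_zero_zero_sq {t T : ℝ} (h : t < T) :
    doubleCoeff t T 0 0 ^ 2 = (T - t) ^ 2 / 4 := by
  rw [doubleCoeff_sq h, polyIntegral_legendrePoly_mul_primitive_zero]
  norm_num
  ring

theorem doubleCoeff_succ_self_sq {t T : ℝ} (h : t < T) (j : ℕ) :
    doubleCoeff t T (j + 1) j ^ 2 = (T - t) ^ 2 / 4 * (1 / (4 * ((j + 1 : ℕ) : ℝ) ^ 2 - 1)) := by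
  have e : 4 * ((j + 1 : ℕ) : ℝ) ^ 2 - 1 = (2 * j + 1) * (2 * j + 3) := by push_cast; ring
  rw [doubleCoeff_sq h, e]
  cases j with
  | zero =>
    rw [polyIntegral_legendrePoly_mul_primitive_zero]
    norm_num
    ring
  | succ j =>
    rw [polyIntegral_legendrePoly_mul_primitive_succ, if_pos rfl, if_neg (by lia)]
    push_cast
    field_simp
    ring

theorem doubleCoeff_self_succ_sq {t T : ℝ} (h : t < T) (j : ℕ) :
    doubleCoeff t T j (j + 1) ^ 2 = (T - t) ^ 2 / 4 * (1 / (4 * ((j + 1 : ℕ) : ℝ) ^ 2 - 1)) := by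
  have e : 4 * ((j + 1 : ℕ) : ℝ) ^ 2 - 1 = (2 * j + 1) * (2 * j + 3) := by push_cast; ring
  rw [doubleCoeff_sq h, e, polyIntegral_legendrePoly_mul_primitive_succ, if_neg (by lia),
    if_pos rfl]
  push_cast
  field_simp
  ring

theorem sum_doubleCoeff_sq {t T : ℝ} (h : t < T) (q : ℕ) :
    ∑ j ∈ Finset.range (q + 1), ∑ k ∈ Finset.range (q + 1), doubleCoeff t T k j ^ 2 =
      (T - t) ^ 2 / 4 + (T - t) ^ 2 / 2 * ∑ i ∈ Finset.Icc 1 q, 1 / (4 * (i : ℝ) ^ 2 - 1) := by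
  induction q with
  | zero => simp [doubleCoeff_zero_zero_sq h]
  | succ q ih =>
    have hrow : ∑ j ∈ Finset.range (q + 1), doubleCoeff t T (q + 1) j ^ 2 =
        doubleCoeff t T (q + 1) q ^ 2 := by
      refine Finset.sum_eq_single q (fun j hj hne => ?_) (by simp)
      rw [Finset.mem_range] at hj
      rw [doubleCoeff_eq_zero h (by lia) (by lia) (by lia), zero_pow two_ne_zero]
    have hcol : ∑ k ∈ Finset.range (q + 2), doubleCoeff t T k (q + 1) ^ 2 =
        doubleCoeff t T q (q + 1) ^ 2 := by
      refine Finset.sum_eq_single q (fun k hk hne => ?_) (by simp)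
      rw [Finset.mem_range] at hk
      rw [doubleCoeff_eq_zero h (by lia) (by lia) (by lia), zero_pow two_ne_zero]
    rw [Finset.sum_range_succ, hcol]
    simp_rw [Finset.sum_range_succ _ (q + 1)]
    rw [Finset.sum_add_distrib, ih, hrow, doubleCoeff_succ_self_sq h, doubleCoeff_self_succ_sq h,
      Finset.sum_Icc_succ_top (by lia)]
    ring

theorem integral_indicator_sub_sq {a b x : ℝ} (hx : x ∈ Set.Icc a b) {s : ℝ → ℝ}
    (hs : Continuous s) :
    ∫ y in Set.Icc a b, ((if x < y then (1 : ℝ) else 0) - s y) ^ 2 =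
      (b - x) - 2 * (∫ y in x..b, s y) + ∫ y in a..b, s y ^ 2 := by
  have hle : Set.EqOn (fun y => s y ^ 2)
      (fun y => ((if x < y then (1 : ℝ) else 0) - s y) ^ 2) (Set.uIoc a x) := fun y hy => by
    rw [Set.uIoc_of_le hx.1] at hy
    simp [not_lt.2 hy.2]
  have hgt : Set.EqOn (fun y => 1 - 2 * s y + s y ^ 2)
      (fun y => ((if x < y then (1 : ℝ) else 0) - s y) ^ 2) (Set.uIoc x b) := fun y hy => by
    rw [Set.uIoc_of_le hx.2] at hy
    simp only [hy.1, if_true]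
    ring
  have hsq : ∀ c d, IntervalIntegrable (fun y => s y ^ 2) volume c d := fun c d =>
    (hs.pow 2).intervalIntegrable c d
  have hlin : ∀ c d, IntervalIntegrable (fun y => 1 - 2 * s y) volume c d := fun c d =>
    Continuous.intervalIntegrable (by fun_prop) c d
  rw [integral_Icc_eq_integral_Ioc, ← intervalIntegral.integral_of_le (hx.1.trans hx.2),
    ← integral_add_adjacent_intervals ((hsq a x).congr hle)
      (((hlin x b).add (hsq x b)).congr hgt),
    ← integral_congr_ae (Filter.Eventually.of_forall fun y hy => hle hy),
    ← integral_congr_ae (Filter.Eventually.of_forall fun y hy => hgt hy),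
    intervalIntegral.integral_add (hlin x b) (hsq x b),
    intervalIntegral.integral_sub (by simp) (Continuous.intervalIntegrable (by fun_prop) _ _),
    intervalIntegral.integral_const_mul, ← integral_add_adjacent_intervals (hsq a x) (hsq x b)]
  simp
  ring

theorem integral_sum_mul_sq {a b : ℝ} {φ : ℕ → ℝ → ℝ} (hφ : ∀ j, Continuous (φ j))
    (horth : ∀ i j, ∫ x in a..b, φ i x * φ j x = if i = j then 1 else 0)
    (c : ℕ → ℝ) (s : Finset ℕ) :
    ∫ x in a..b, (∑ j ∈ s, c j * φ j x) ^ 2 = ∑ j ∈ s, c j ^ 2 := by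
  have e : ∀ x, (∑ j ∈ s, c j * φ j x) ^ 2 =
      ∑ i ∈ s, ∑ j ∈ s, c i * c j * (φ i x * φ j x) := fun x => by
    rw [sq, Finset.sum_mul_sum]
    exact Finset.sum_congr rfl fun i _ => Finset.sum_congr rfl fun j _ => by ring
  simp_rw [e]
  rw [intervalIntegral.integral_finsetSum
    fun i _ => Continuous.intervalIntegrable (by fun_prop) _ _]
  refine Finset.sum_congr rfl fun i hi => ?_
  rw [intervalIntegral.integral_finsetSum
    fun j _ => Continuous.intervalIntegrable (by fun_prop) _ _]
  simp_rw [intervalIntegral.integral_const_mul, horth]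
  simp [hi, sq]

theorem integral_mul_integral_right {a b : ℝ} {f g : ℝ → ℝ} (hf : Continuous f)
    (hg : Continuous g) :
    ∫ x in a..b, f x * ∫ y in x..b, g y = ∫ y in a..b, g y * ∫ x in a..y, f x := by
  have h := integral_mul_deriv_eq_deriv_mul (a := a) (b := b)
    (u := fun x => ∫ y in x..b, g y) (v := fun x => ∫ y in a..x, f y)
    (u' := fun x => -g x) (v' := f)
    (fun x _ => integral_hasDerivAt_left (hg.intervalIntegrable _ _)
      hg.stronglyMeasurable.stronglyMeasurableAtFilter hg.continuousAt)
    (fun x _ => integral_hasDerivAt_right (hf.intervalIntegrable _ _)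
      hf.stronglyMeasurable.stronglyMeasurableAtFilter hf.continuousAt)
    (hg.neg.intervalIntegrable _ _) (hf.intervalIntegrable _ _)
  simp only [integral_same, zero_mul, mul_zero, sub_zero, zero_sub, neg_mul,
    intervalIntegral.integral_neg, neg_neg] at h
  rw [← h]
  exact integral_congr fun x _ => mul_comm _ _

/-- Mean-square error of the double Fourier expansion of `1_{x < y}` in an orthonormal system. -/
theorem integral_indicator_sub_sum_sq {a b : ℝ} (hab : a ≤ b) {φ : ℕ → ℝ → ℝ}
    (hφ : ∀ j, Continuous (φ j))
    (horth : ∀ i j, ∫ x in a..b, φ i x * φ j x = if i = j then 1 else 0)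
    {c : ℕ → ℕ → ℝ} (hc : ∀ k j, c k j = ∫ y in a..b, φ k y * ∫ x in a..y, φ j x)
    (s : Finset ℕ) :
    ∫ x in Set.Icc a b, ∫ y in Set.Icc a b, ((if x < y then (1 : ℝ) else 0) -
        ∑ j ∈ s, ∑ k ∈ s, c k j * φ j x * φ k y) ^ 2 =
      (b - a) ^ 2 / 2 - ∑ j ∈ s, ∑ k ∈ s, c k j ^ 2 := by
  have hprim : ∀ k, Continuous fun x => ∫ y in x..b, φ k y := fun k => by
    simp_rw [integral_symm b]
    exact (continuous_primitive (fun _ _ => (hφ k).intervalIntegrable _ _) b).neg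
  have inner : ∀ x ∈ Set.Icc a b,
      ∫ y in Set.Icc a b, ((if x < y then (1 : ℝ) else 0) -
        ∑ j ∈ s, ∑ k ∈ s, c k j * φ j x * φ k y) ^ 2 =
      (b - x) - 2 * (∑ j ∈ s, ∑ k ∈ s, c k j * (φ j x * ∫ y in x..b, φ k y)) +
        ∑ k ∈ s, (∑ j ∈ s, c k j * φ j x) ^ 2 := fun x hx => by
    rw [integral_indicator_sub_sq hx (by fun_prop), ← integral_sum_mul_sq hφ horth]
    congr 2
    · congr 1
      rw [intervalIntegral.integral_finsetSum
        fun j _ => Continuous.intervalIntegrable (by fun_prop) _ _]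
      refine Finset.sum_congr rfl fun j _ => ?_
      rw [intervalIntegral.integral_finsetSum
        fun k _ => Continuous.intervalIntegrable (by fun_prop) _ _]
      simp_rw [intervalIntegral.integral_const_mul, mul_assoc]
    · ext y
      rw [Finset.sum_comm]
      simp_rw [Finset.sum_mul]
  rw [setIntegral_congr_fun measurableSet_Icc inner, integral_Icc_eq_integral_Ioc,
    ← intervalIntegral.integral_of_le hab,
    intervalIntegral.integral_add (Continuous.intervalIntegrable (by fun_prop) _ _)
      (Continuous.intervalIntegrable (by fun_prop) _ _),
    intervalIntegral.integral_sub (Continuous.intervalIntegrable (by fun_prop) _ _)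
      (Continuous.intervalIntegrable (by fun_prop) _ _),
    intervalIntegral.integral_const_mul,
    intervalIntegral.integral_finsetSum
      fun j _ => Continuous.intervalIntegrable (by fun_prop) _ _,
    intervalIntegral.integral_finsetSum
      fun j _ => Continuous.intervalIntegrable (by fun_prop) _ _]
  simp_rw [integral_sum_mul_sq hφ horth]
  have hcross : ∀ j ∈ s, ∫ x in a..b, ∑ k ∈ s, c k j * (φ j x * ∫ y in x..b, φ k y) =
      ∑ k ∈ s, c k j ^ 2 := fun j _ => by
    rw [intervalIntegral.integral_finsetSum
      fun k _ => Continuous.intervalIntegrable (by fun_prop) _ _]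
    refine Finset.sum_congr rfl fun k _ => ?_
    rw [intervalIntegral.integral_const_mul, integral_mul_integral_right (hφ j) (hφ k), ← hc, sq]
  have hlin : ∫ x in a..b, (b - x) = (b - a) ^ 2 / 2 := by
    rw [intervalIntegral.integral_sub (by simp) (by simp), intervalIntegral.integral_const,
      integral_id, smul_eq_mul]
    ring
  rw [Finset.sum_congr rfl hcross, Finset.sum_comm (f := fun k j => c k j ^ 2), hlin]
  ring

/-- Exact mean-square truncation error of the double Fourier–Legendre series of `1_{{t₁<t₂}}`. -/
theorem double_fourier_legendre_truncation_error (t T : ℝ) (h : t < T) (q : ℕ) :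
    (∫ t₁ in Set.Icc t T, ∫ t₂ in Set.Icc t T,
      ((if t₁ < t₂ then (1 : ℝ) else 0) -
        ∑ j₁ ∈ Finset.range (q + 1), ∑ j₂ ∈ Finset.range (q + 1),
          doubleCoeff t T j₂ j₁ * legendreFun t T j₁ t₁ * legendreFun t T j₂ t₂) ^ 2)
      = (T - t) ^ 2 / 2 *
          (1 / 2 - ∑ i ∈ Finset.Icc 1 q, 1 / (4 * (i : ℝ) ^ 2 - 1)) := by
  rw [integral_indicator_sub_sum_sq h.le (continuous_legendreFun t T) (integral_legendreFun_mul h)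
    (c := doubleCoeff t T) (fun _ _ => rfl), sum_doubleCoeff_sq h]
  ring
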